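/- arXiv:0808.3881 — 5 statements merged into one kernel-verified Lean document; each statement's English description precedes it below -/
import Mathlib

section
/- Every closed right-turn walk W in the brickwall 𝓑 has turning number t(W) ≥ 1. -/
open scoped Classical

namespace Hex

/-- Adjacency in the brickwall `𝓑`: vertex `(i,j)` is `b_{i,j}`.
Horizontal edges `b_{i,j} b_{i+1,j}` for all `i,j`, and vertical edges
`b_{i,j} b_{i+1,j+1}` for odd `i`. -/
def bwAdj (u v : ℤ × ℤ) : Prop :=
  (u.2 = v.2 ∧ (v.1 = u.1 + 1 ∨ u.1 = v.1 + 1)) ∨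
  (Odd u.1 ∧ v.1 = u.1 + 1 ∧ v.2 = u.2 + 1) ∨
  (Odd v.1 ∧ u.1 = v.1 + 1 ∧ u.2 = v.2 + 1)

/-- A closed walk of length `k` in the brickwall, represented by a `k`-periodic
function `f : ℤ → ℤ × ℤ` (so `W_i = f i`), with adjacency and no turning back. -/
def IsClosedWalk (k : ℕ) (f : ℤ → ℤ × ℤ) : Prop :=
  0 < k ∧ (∀ i : ℤ, f (i + (k : ℤ)) = f i) ∧ (∀ i : ℤ, bwAdj (f i) (f (i + 1))) ∧
    (∀ i : ℤ, f (i - 1) ≠ f (i + 1))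

/-- The neighbor of `v` immediately following `u` in the clockwise order
around `v` in the planar drawing of the brickwall:
around `b_{i,j}` with `i` odd the clockwise order is
`(b_{i+1,j+1}, b_{i+1,j}, b_{i-1,j})`, and with `i` even it is
`(b_{i+1,j}, b_{i-1,j-1}, b_{i-1,j})`. -/
def cwNext (v u : ℤ × ℤ) : ℤ × ℤ :=
  if v.1 % 2 = 0 then
    (if u = (v.1 + 1, v.2) then (v.1 - 1, v.2 - 1)
     else if u = (v.1 - 1, v.2 - 1) then (v.1 - 1, v.2)
     else (v.1 + 1, v.2))
  else
    (if u = (v.1 + 1, v.2 + 1) then (v.1 + 1, v.2)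
     else if u = (v.1 + 1, v.2) then (v.1 - 1, v.2)
     else (v.1 + 1, v.2 + 1))

/-- `W` makes a right turn at `i`: `W_{i-1}` immediately follows `W_{i+1}` clockwise. -/
def RightTurn (f : ℤ → ℤ × ℤ) (i : ℤ) : Prop := f (i - 1) = cwNext (f i) (f (i + 1))

/-- `W` makes a left turn at `i`: `W_{i+1}` immediately follows `W_{i-1}` clockwise. -/
def LeftTurn (f : ℤ → ℤ × ℤ) (i : ℤ) : Prop := f (i + 1) = cwNext (f i) (f (i - 1))

noncomputable def rightCount (k : ℕ) (f : ℤ → ℤ × ℤ) : ℕ :=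
  ((Finset.range k).filter fun t => RightTurn f (t : ℤ)).card

noncomputable def leftCount (k : ℕ) (f : ℤ → ℤ × ℤ) : ℕ :=
  ((Finset.range k).filter fun t => LeftTurn f (t : ℤ)).card

/-- The turning number `t(W) = (Right(W) - Left(W))/6`. -/
noncomputable def turningNumber (k : ℕ) (f : ℤ → ℤ × ℤ) : ℚ :=
  ((rightCount k f : ℚ) - (leftCount k f : ℚ)) / 6

/-- `uv` is a horizontal right edge: same height, smaller first coordinate even. -/
def HorizRight (u v : ℤ × ℤ) : Prop := u.2 = v.2 ∧ Even (min u.1 v.1)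

/-- `uv` is a horizontal left edge: same height, smaller first coordinate odd. -/
def HorizLeft (u v : ℤ × ℤ) : Prop := u.2 = v.2 ∧ Odd (min u.1 v.1)

/-- A right-turn walk: every vertical edge is immediately followed by a horizontal
right edge and immediately preceded by a horizontal left edge. -/
def IsRightTurnWalk (f : ℤ → ℤ × ℤ) : Prop :=
  ∀ i : ℤ, (f i).2 ≠ (f (i + 1)).2 →
    HorizRight (f (i + 1)) (f (i + 2)) ∧ HorizLeft (f (i - 1)) (f i)

/-- The unique neighbor of `W_i` other than `W_{i-1}` and `W_{i+1}`. -/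
def thirdNb (f : ℤ → ℤ × ℤ) (i : ℤ) : ℤ × ℤ :=
  if cwNext (f i) (f (i + 1)) = f (i - 1) then cwNext (f i) (f (i - 1))
  else cwNext (f i) (f (i + 1))

/-- `i ∈ {0,…,k-1}` is a PA-index: `W` makes a left turn at `i` and the third
neighbor of `W_i` has the same height as `W_i`. -/
def IsPAIndex (k : ℕ) (f : ℤ → ℤ × ℤ) (i : ℤ) : Prop :=
  0 ≤ i ∧ i < (k : ℤ) ∧ LeftTurn f i ∧ (thirdNb f i).2 = (f i).2

/-- The horizontal path in the brickwall from `u` to `v` (same height), as a list. -/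
def horizPath (u v : ℤ × ℤ) : List (ℤ × ℤ) :=
  if u.1 ≤ v.1 then (List.range ((v.1 - u.1).toNat + 1)).map fun t => (u.1 + (t : ℤ), u.2)
  else (List.range ((u.1 - v.1).toNat + 1)).map fun t => (u.1 - (t : ℤ), u.2)

/-- `p = {x,y}` is a possible assignment (PA) of the closed walk. -/
def IsPA (k : ℕ) (f : ℤ → ℤ × ℤ) (p : Finset ℤ) : Prop :=
  ∃ x y : ℤ, p = {x, y} ∧ IsPAIndex k f x ∧ IsPAIndex k f y ∧
    f x ≠ f y ∧ (f x).2 = (f y).2 ∧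
    ∀ z ∈ horizPath (f x) (f y),
      z ≠ f (x - 1) ∧ z ≠ f (x + 1) ∧ z ≠ f (y - 1) ∧ z ≠ f (y + 1)

/-- A proper assignment set: a set of PAs forming a non-crossing perfect matching
on the PA-indices. -/
def IsProperAssignment (k : ℕ) (f : ℤ → ℤ × ℤ) (A : Set (Finset ℤ)) : Prop :=
  (∀ p ∈ A, IsPA k f p) ∧
  (∀ i : ℤ, IsPAIndex k f i → ∃! p, p ∈ A ∧ i ∈ p) ∧
  (∀ p ∈ A, ∀ q ∈ A, ∀ i ∈ p, ∀ j ∈ p, ∀ x ∈ q, ∀ y ∈ q, ¬(i < x ∧ x < j ∧ j < y))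

/-- `n(i)`: the first PA-index strictly after `i` in cyclic order
(minimizing the cyclic distance `((j - i - 1) mod k) + 1`). -/
noncomputable def nextPA (k : ℕ) (f : ℤ → ℤ × ℤ) (i : ℤ) : ℤ :=
  if h : ∃ j : ℤ, IsPAIndex k f j ∧ ∀ j' : ℤ, IsPAIndex k f j' →
      (j - i - 1) % (k : ℤ) ≤ (j' - i - 1) % (k : ℤ)
  then h.choose else 0

/-- The subwalk `W_{x,y}` of the closed walk, as a list of `((y-x) mod k) + 1` vertices. -/
def subwalkList (k : ℕ) (f : ℤ → ℤ × ℤ) (x y : ℤ) : List (ℤ × ℤ) :=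
  (List.range (((y - x) % (k : ℤ)).toNat + 1)).map fun t => f (x + (t : ℤ))

/-- The cyclic function `ℤ → ℤ × ℤ` determined by a list of vertices. -/
def listFun (L : List (ℤ × ℤ)) : ℤ → ℤ × ℤ :=
  fun z => L.getD ((z % (L.length : ℤ)).toNat) (0, 0)

/-- An elementary cycle of `(W, A)`, given by its index sequence
`i_0, …, i_l` of PA-indices with `{n(i_t), i_{t+1}} ∈ A`, `{n(i_l), i_0} ∈ A`,
and canonical rotation `i_0 < i_t` for `t ≥ 1`. -/
structure ElemCycle (k : ℕ) (f : ℤ → ℤ × ℤ) (A : Set (Finset ℤ)) where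
  l : ℕ
  idx : ℕ → ℤ
  pa : ∀ t : ℕ, t ≤ l → IsPAIndex k f (idx t)
  mem : ∀ t : ℕ, t < l → ({nextPA k f (idx t), idx (t + 1)} : Finset ℤ) ∈ A
  memLast : ({nextPA k f (idx l), idx 0} : Finset ℤ) ∈ A
  minimal : ∀ t : ℕ, 1 ≤ t → t ≤ l → idx 0 < idx t
  canon : ∀ t : ℕ, l < t → idx t = idx 0

/-- The `t`-th segment `W_{i_t, n(i_t)} ∘ H_{n(i_t), i_{t+1}}` of an elementary
cycle (with final vertex dropped, for concatenation). -/
noncomputable def ecSegment {k : ℕ} {f : ℤ → ℤ × ℤ} {A : Set (Finset ℤ)}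
    (E : ElemCycle k f A) (t : ℕ) : List (ℤ × ℤ) :=
  (subwalkList k f (E.idx t) (nextPA k f (E.idx t))).dropLast ++
  (horizPath (f (nextPA k f (E.idx t))) (f (E.idx (if t = E.l then 0 else t + 1)))).dropLast

/-- The closed walk `C = W_{i_0,n(i_0)} ∘ H_{n(i_0),i_1} ∘ ⋯ ∘ H_{n(i_l),i_0}` of an
elementary cycle, as a list (without the repeated final vertex). -/
noncomputable def ecOpenList {k : ℕ} {f : ℤ → ℤ × ℤ} {A : Set (Finset ℤ)}
    (E : ElemCycle k f A) : List (ℤ × ℤ) :=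
  (List.range (E.l + 1)).flatMap (ecSegment E)

/-- The length of the closed walk of an elementary cycle. -/
noncomputable def ecLen {k : ℕ} {f : ℤ → ℤ × ℤ} {A : Set (Finset ℤ)}
    (E : ElemCycle k f A) : ℕ := (ecOpenList E).length

/-- The closed walk of an elementary cycle, as a periodic function. -/
noncomputable def ecFun {k : ℕ} {f : ℤ → ℤ × ℤ} {A : Set (Finset ℤ)}
    (E : ElemCycle k f A) : ℤ → ℤ × ℤ := listFun (ecOpenList E)

/-- `(m, g)` is (the closed walk of) an elementary cycle of `(W, A)`; if `A = ∅`
and `W` has no PA-index, `W` itself is the unique elementary cycle. -/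
def IsElemCycleWalk (k : ℕ) (f : ℤ → ℤ × ℤ) (A : Set (Finset ℤ))
    (m : ℕ) (g : ℤ → ℤ × ℤ) : Prop :=
  (∃ E : ElemCycle k f A, m = ecLen E ∧ g = ecFun E) ∨
  (A = ∅ ∧ (∀ i : ℤ, ¬ IsPAIndex k f i) ∧ m = k ∧ g = f)

/-- The number of elementary cycles of `(W, A)` (elementary cycles being
identified with their index sequences). -/
noncomputable def numElemCycles (k : ℕ) (f : ℤ → ℤ × ℤ) (A : Set (Finset ℤ)) : ℕ :=
  if A = ∅ ∧ ∀ i : ℤ, ¬ IsPAIndex k f i then 1 else Nat.card (ElemCycle k f A)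

/-- The number of PA-indices of the closed walk. -/
noncomputable def paCount (k : ℕ) (f : ℤ → ℤ × ℤ) : ℕ :=
  Nat.card {i : ℤ // IsPAIndex k f i}

/-- The walk `W' = W_{0,y} ∘ H_{y,0}`, as a list (without repeated final vertex). -/
noncomputable def splitList (k : ℕ) (f : ℤ → ℤ × ℤ) (y : ℤ) : List (ℤ × ℤ) :=
  (subwalkList k f 0 y).dropLast ++ (horizPath (f y) (f 0)).dropLast

/-- The length of the walk `W' = W_{0,y} ∘ H_{y,0}`. -/
noncomputable def splitLen (k : ℕ) (f : ℤ → ℤ × ℤ) (y : ℤ) : ℕ := (splitList k f y).length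

/-- The walk `W' = W_{0,y} ∘ H_{y,0}`, as a periodic function. -/
noncomputable def splitFun (k : ℕ) (f : ℤ → ℤ × ℤ) (y : ℤ) : ℤ → ℤ × ℤ :=
  listFun (splitList k f y)

/-- `Σ_{C ∈ 𝒞} (t(C) - 1)` over the set `𝒞` of elementary cycles of `(W, A)`. -/
noncomputable def elemTurnSum (k : ℕ) (f : ℤ → ℤ × ℤ) (A : Set (Finset ℤ)) : ℚ :=
  if A = ∅ ∧ ∀ i : ℤ, ¬ IsPAIndex k f i then turningNumber k f - 1
  else ∑ᶠ E : ElemCycle k f A, (turningNumber (ecLen E) (ecFun E) - 1)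

lemma bwAdj_symm {u v : ℤ × ℤ} (h : bwAdj u v) : bwAdj v u := by
  simp only [bwAdj, Int.odd_iff] at *
  omega

/-- The neighbors of a vertex, according to the parity of its first coordinate. -/
lemma eq_of_bwAdj {u v : ℤ × ℤ} (h : bwAdj v u) :
    (v.1 % 2 = 0 ∧ (u = (v.1 + 1, v.2) ∨ u = (v.1 - 1, v.2 - 1) ∨ u = (v.1 - 1, v.2))) ∨
    (v.1 % 2 = 1 ∧ (u = (v.1 + 1, v.2 + 1) ∨ u = (v.1 + 1, v.2) ∨ u = (v.1 - 1, v.2))) := by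
  obtain ⟨a, b⟩ := u
  obtain ⟨c, d⟩ := v
  simp only [bwAdj, Int.odd_iff, Prod.mk.injEq] at *
  omega

/-- A potential on edges: `-1` on vertical, `0` on horizontal right and `1` on horizontal
left edges. A right turn raises it by `1` modulo `3`. -/
def edgePotential (u v : ℤ × ℤ) : ℤ :=
  if u.2 ≠ v.2 then -1 else if min u.1 v.1 % 2 = 0 then 0 else 1

/-- In a right-turn walk, the signed turn at a vertex is the change of the edge potential, plus `3`
when the outgoing edge is vertical. -/
lemma turn_eq_edgePotential {u v w : ℤ × ℤ} (huv : bwAdj u v) (hvw : bwAdj v w) (huw : u ≠ w)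
    (hin : u.2 ≠ v.2 → HorizRight v w) (hout : v.2 ≠ w.2 → HorizLeft u v) :
    (if u = cwNext v w then 1 else 0) - (if w = cwNext v u then 1 else 0) =
      edgePotential v w - edgePotential u v + 3 * |w.2 - v.2| := by
  obtain ⟨a, b⟩ := v
  have h1 : a - 1 ≠ a + 1 := by omega
  have h2 : a + 1 ≠ a - 1 := by omega
  have h3 : b ≠ b - 1 := by omega
  rcases eq_of_bwAdj hvw with ⟨hp, hw⟩ | ⟨hp, hw⟩ <;>
  rcases eq_of_bwAdj (bwAdj_symm huv) with ⟨hp', hu⟩ | ⟨hp', hu⟩ <;>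
  dsimp only at hp hp' hw hu <;>
  first
  | (exfalso; omega)
  | have hq : (a - 1) % 2 = 1 - a % 2 := by omega
    rw [hp] at hq
    rcases hw with rfl | rfl | rfl <;> rcases hu with rfl | rfl | rfl <;>
    simp [cwNext, edgePotential, HorizLeft, HorizRight, Int.even_iff, Int.odd_iff, hp, hq, h1, h2,
      h3] at huw hin hout ⊢

lemma bwAdj_abs_height {u v : ℤ × ℤ} (h : bwAdj u v) :
    |v.2 - u.2| = 0 ∨ |v.2 - u.2| = 1 := by
  rw [abs_eq_max_neg]
  unfold bwAdj at h
  omega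

/-- A closed walk uses a vertical edge. -/
lemma IsClosedWalk.exists_vertical {k : ℕ} {f : ℤ → ℤ × ℤ} (hW : IsClosedWalk k f) :
    ∃ i : ℤ, (f i).2 ≠ (f (i + 1)).2 := by
  obtain ⟨hk, hper, hadj, hback⟩ := hW
  by_contra! hflat
  have hstep (i : ℤ) : (f (i + 1)).1 - (f i).1 = 1 ∨ (f (i + 1)).1 - (f i).1 = -1 := by
    have h1 := hadj i
    have h2 := hflat i
    unfold bwAdj at h1
    omega
  have hconst (i : ℤ) : (f (i + 1 + 1)).1 - (f (i + 1)).1 = (f (i + 1)).1 - (f i).1 := by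
    have hne : f i ≠ f (i + 1 + 1) := by simpa using hback (i + 1)
    have hy := (hflat i).trans (hflat (i + 1))
    have hx : (f i).1 ≠ (f (i + 1 + 1)).1 := fun h => hne (Prod.ext h hy)
    have h1 := hstep i
    have h2 := hstep (i + 1)
    omega
  have hlin (n : ℕ) : (f n).1 = (f 0).1 + n * ((f 1).1 - (f 0).1) ∧
      (f (n + 1)).1 - (f n).1 = (f 1).1 - (f 0).1 := by
    induction n with
    | zero => simp
    | succ n ih =>
      have h := hconst n
      push_cast
      exact ⟨by linarith, by linarith⟩
  have hend : (f k).1 = (f 0).1 := by simpa using congrArg Prod.fst (hper 0)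
  have hzero := (hlin k).1
  have h01 : (f 1).1 - (f 0).1 = 1 ∨ (f 1).1 - (f 0).1 = -1 := by simpa using hstep 0
  rcases h01 with h | h <;> rw [h] at hzero <;> omega

/-- A closed walk uses at least two vertical edges. -/
lemma IsClosedWalk.two_le_sum_abs_height {k : ℕ} {f : ℤ → ℤ × ℤ} (hW : IsClosedWalk k f) :
    2 ≤ ∑ t ∈ Finset.range k, |(f (t + 1)).2 - (f t).2| := by
  obtain ⟨i, hi⟩ := hW.exists_vertical
  obtain ⟨hk, hper, hadj, -⟩ := hW
  have hmod (i : ℤ) : f (i % k) = f i := by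
    have h : Function.Periodic f (k : ℤ) := hper
    rw [Int.emod_def, mul_comm]
    exact h.sub_int_mul_eq _
  have hsum : ∑ t ∈ Finset.range k, ((f (t + 1)).2 - (f t).2) = 0 := by
    have h := Finset.sum_range_sub (fun n : ℕ => (f n).2) k
    have hend : f k = f 0 := by simpa using hper 0
    simpa [hend] using h
  have heven : 2 ∣ ∑ t ∈ Finset.range k, |(f (t + 1)).2 - (f t).2| := by
    rw [← add_zero (∑ t ∈ Finset.range k, |(f (t + 1)).2 - (f t).2|), ← hsum,
      ← Finset.sum_add_distrib]
    refine Finset.dvd_sum fun t _ => ?_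
    have := bwAdj_abs_height (hadj t)
    rw [abs_eq_max_neg] at *
    omega
  have hk0 : (0 : ℤ) < k := by exact_mod_cast hk
  have hpos : 0 < ∑ t ∈ Finset.range k, |(f (t + 1)).2 - (f t).2| := by
    refine Finset.sum_pos' (fun t _ => abs_nonneg _) ⟨(i % k).toNat, ?_, ?_⟩
    · have := Int.emod_lt_of_pos i hk0
      rw [Finset.mem_range]
      omega
    · rw [Int.toNat_of_nonneg (Int.emod_nonneg i hk0.ne'), ← hmod (i % k + 1), Int.emod_add_emod,
        hmod, hmod]
      exact abs_pos.mpr (sub_ne_zero.mpr hi.symm)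
  omega

/-- The signed number of turns of a closed right-turn walk is three times its number of vertical
edges. -/
lemma rightCount_sub_leftCount {k : ℕ} {f : ℤ → ℤ × ℤ} (hW : IsClosedWalk k f)
    (hR : IsRightTurnWalk f) :
    (rightCount k f : ℤ) - leftCount k f =
      3 * ∑ t ∈ Finset.range k, |(f (t + 1)).2 - (f t).2| := by
  obtain ⟨-, hper, hadj, hback⟩ := hW
  have hturn (i : ℤ) : (if RightTurn f i then 1 else 0) - (if LeftTurn f i then 1 else 0) =
      edgePotential (f i) (f (i + 1)) - edgePotential (f (i - 1)) (f i) +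
        3 * |(f (i + 1)).2 - (f i).2| := by
    unfold RightTurn LeftTurn
    convert turn_eq_edgePotential (by simpa using hadj (i - 1)) (hadj i) (hback i)
      (fun h => ?_) (fun h => (hR i h).2)
    have h' := (hR (i - 1) (by simpa using h)).1
    rwa [sub_add_cancel, show i - 1 + 2 = i + 1 by ring] at h'
  have htel : ∑ t ∈ Finset.range k,
      (edgePotential (f t) (f (t + 1)) - edgePotential (f (t - 1)) (f t)) = 0 := by
    have h := Finset.sum_range_sub (fun n : ℕ => edgePotential (f (n - 1)) (f n)) k
    have hend : f k = f 0 := by simpa using hper 0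
    have hend' : f (k - 1) = f (-1) := by
      rw [← hper (-1), neg_add_eq_sub]
    simpa [hend, hend'] using h
  have hrange : (do let a ← Finset.range k; pure (a : ℤ)) =
      (Finset.range k).image ((↑) : ℕ → ℤ) := by
    ext
    simp [eq_comm]
  simp only [rightCount, leftCount, Finset.card_filter, hrange]
  rw [Finset.sum_image (by simp), Finset.sum_image (by simp)]
  push_cast
  rw [← Finset.sum_sub_distrib, Finset.mul_sum, Finset.sum_congr rfl fun (t : ℕ) _ => hturn t,
    Finset.sum_add_distrib, htel, zero_add]

/-- Every closed right-turn walk `W` in the brickwall `𝓑` has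
turning number `t(W) ≥ 1`. -/
theorem turningNumber_ge_one_of_rightTurnWalk
    (k : ℕ) (f : ℤ → ℤ × ℤ) (hW : IsClosedWalk k f) (hR : IsRightTurnWalk f) :
    1 ≤ turningNumber k f := by
  have hcount := rightCount_sub_leftCount hW hR
  have htwo := hW.two_le_sum_abs_height
  have h6 : (6 : ℤ) ≤ (rightCount k f : ℤ) - leftCount k f := by omega
  have h6' : (6 : ℚ) ≤ (rightCount k f : ℚ) - leftCount k f := by exact_mod_cast h6
  rw [turningNumber, le_div_iff₀ (by norm_num)]
  linarith

end Hex
end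

section
/- Let W be a closed right-turn walk in the brickwall 𝓑 with turning number t(W) = 1. Then W is a cycle (no vertex is repeated) containing exactly two vertical edges; more precisely, some rotation of W equals the sequence b_{a,j}, b_{a+1,j+1}, b_{a+2,j+1}, …, b_{a+2i+1,j+1}, b_{a+2i,j}, b_{a+2i−1,j}, …, b_{a+1,j}, b_{a,j} for some odd a ∈ ℤ, some j ∈ ℤ and some integer i ≥ 1. -/
open scoped Classical

namespace Hex

/-- A potential on edges whose increments, corrected by `3` for each vertical edge, are the
turns of a right-turn walk. -/
noncomputable def turnPotential (u v : ℤ × ℤ) : ℤ :=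
  if u.2 ≠ v.2 then -1 else if Odd (min u.1 v.1) then 1 else 0

theorem bwAdj.fst_eq_add_one_or_sub_one {u v : ℤ × ℤ} (h : bwAdj u v) :
    v.1 = u.1 + 1 ∨ v.1 = u.1 - 1 := by
  unfold bwAdj at h
  omega

/-- Along a right-turn walk, the height changes exactly when the horizontal direction does. -/
theorem height_sub_eq {P Q R : ℤ × ℤ} (hPQ : bwAdj P Q) (hQR : bwAdj Q R) (hne : P ≠ R)
    (hright : P.2 ≠ Q.2 → HorizRight Q R) (hleft : Q.2 ≠ R.2 → HorizLeft P Q) :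
    2 * (R.2 - Q.2) = (R.1 - Q.1) - (Q.1 - P.1) := by
  obtain ⟨p, p'⟩ := P
  obtain ⟨q, q'⟩ := Q
  obtain ⟨r, r'⟩ := R
  simp only [bwAdj, HorizRight, HorizLeft, ne_eq, Prod.mk.injEq, Int.odd_iff,
    Int.even_iff] at *
  omega

theorem turn_eq_turnPotential_sub {P Q R : ℤ × ℤ} (hPQ : bwAdj P Q) (hQR : bwAdj Q R)
    (hne : P ≠ R) (hright : P.2 ≠ Q.2 → HorizRight Q R)
    (hleft : Q.2 ≠ R.2 → HorizLeft P Q) :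
    ((if P = cwNext Q R then 1 else 0) - (if R = cwNext Q P then 1 else 0) : ℤ) =
      turnPotential Q R - turnPotential P Q + 3 * (if Q.2 ≠ R.2 then 1 else 0) := by
  obtain ⟨p, p'⟩ := P
  obtain ⟨q, q'⟩ := Q
  obtain ⟨r, r'⟩ := R
  simp only [bwAdj, HorizRight, HorizLeft, ne_eq, Prod.mk.injEq, Int.odd_iff,
    Int.even_iff] at *
  rcases hPQ with ⟨_, _ | _⟩ | hPQ | hPQ <;> rcases hQR with ⟨_, _ | _⟩ | hQR | hQR <;>
    first
    | (exfalso; omega)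
    | grind [turnPotential, cwNext]

/-- The coercion of `Finset.range k` to a set of integers does not change cardinalities. -/
theorem card_filter_range_cast (k : ℕ) (p : ℤ → Prop) [DecidablePred p] :
    ((Finset.range k).filter fun t => p (t : ℤ)).card =
      ((Finset.range k).filter fun t : ℕ => p t).card := by
  have himage : (do let a ← Finset.range k; pure (a : ℤ) : Finset ℤ) =
      (Finset.range k).image (Nat.cast : ℕ → ℤ) := by
    ext
    simp [Finset.bind_def, eq_comm]
  rw [himage, Finset.filter_image, Finset.card_image_of_injective _ Nat.cast_injective]

section Walk

variable {k : ℕ} {f : ℤ → ℤ × ℤ}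

theorem IsRightTurnWalk.horizRight (hR : IsRightTurnWalk f) (i : ℤ)
    (h : (f (i - 1)).2 ≠ (f i).2) : HorizRight (f i) (f (i + 1)) := by
  have := (hR (i - 1) (by simpa using h)).1
  rwa [show i - 1 + 1 = i by ring, show i - 1 + 2 = i + 1 by ring] at this

theorem IsClosedWalk.adj_pred (hW : IsClosedWalk k f) (i : ℤ) : bwAdj (f (i - 1)) (f i) := by
  simpa using hW.2.2.1 (i - 1)

/-- The number of vertical edges of a closed right-turn walk is twice its turning number. -/
theorem card_vertical_eq (hW : IsClosedWalk k f) (hR : IsRightTurnWalk f) :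
    (((Finset.range k).filter fun t : ℕ => (f (t : ℤ)).2 ≠ (f ((t : ℤ) + 1)).2).card : ℚ) =
      2 * turningNumber k f := by
  have hturn : ∀ t ∈ Finset.range k,
      ((if RightTurn f (t : ℤ) then 1 else 0) - (if LeftTurn f (t : ℤ) then 1 else 0) : ℤ) =
        (turnPotential (f (((t + 1 : ℕ) : ℤ) - 1)) (f ((t + 1 : ℕ) : ℤ)) -
          turnPotential (f ((t : ℤ) - 1)) (f t)) +
        3 * (if (f (t : ℤ)).2 ≠ (f ((t : ℤ) + 1)).2 then 1 else 0) := by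
    intro t _
    have := turn_eq_turnPotential_sub (hW.adj_pred t) (hW.2.2.1 t) (hW.2.2.2 t)
      (hR.horizRight t) (fun h => (hR t h).2)
    rw [Nat.cast_succ, add_sub_cancel_right, ← this]
    exact congrArg₂ _ (if_congr Iff.rfl rfl rfl) (if_congr Iff.rfl rfl rfl)
  have hsum := Finset.sum_congr rfl hturn
  rw [Finset.sum_sub_distrib, Finset.sum_add_distrib, ← Finset.mul_sum,
    Finset.sum_range_sub (fun t : ℕ => turnPotential (f ((t : ℤ) - 1)) (f t)),
    Finset.sum_boole, Finset.sum_boole, Finset.sum_boole] at hsum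
  have h₀ : f (k : ℤ) = f 0 := by simpa using hW.2.1 0
  have h₁ : f ((k : ℤ) - 1) = f (0 - 1) := by
    rw [← hW.2.1 (0 - 1)]
    ring_nf
  simp only [Nat.cast_zero, h₀, h₁, sub_self, zero_add] at hsum
  have hsumQ := congrArg (Int.cast : ℤ → ℚ) hsum
  push_cast at hsumQ
  unfold turningNumber rightCount leftCount
  rw [card_filter_range_cast, card_filter_range_cast]
  linarith

/-- A closed right-turn walk stays within two consecutive rows, moving to the right on the upper
one and to the left on the lower one. -/
theorem exists_rows (hW : IsClosedWalk k f) (hR : IsRightTurnWalk f) :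
    ∃ c : ℤ, ∀ i : ℤ, ((f (i + 1)).2 = c ∧ (f (i + 1)).1 = (f i).1 - 1) ∨
      ((f (i + 1)).2 = c + 1 ∧ (f (i + 1)).1 = (f i).1 + 1) := by
  have hstep : ∀ i : ℤ, 2 * (f (i + 1)).2 - ((f (i + 1)).1 - (f i).1) =
      2 * (f i).2 - ((f i).1 - (f (i - 1)).1) := by
    intro i
    have := height_sub_eq (hW.adj_pred i) (hW.2.2.1 i) (hW.2.2.2 i)
      (hR.horizRight i) (fun h => (hR i h).2)
    linarith
  have hconst : ∀ i : ℤ, 2 * (f (i + 1)).2 - ((f (i + 1)).1 - (f i).1) =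
      2 * (f (0 + 1)).2 - ((f (0 + 1)).1 - (f 0).1) := by
    intro i
    induction i using Int.induction_on with
    | zero => rfl
    | succ i ih =>
      have := hstep (i + 1)
      rw [add_sub_cancel_right] at this
      linarith
    | pred i ih =>
      have := hstep (-i)
      rw [sub_add_cancel]
      linarith
  rcases (hW.2.2.1 0).fst_eq_add_one_or_sub_one with h | h
  · refine ⟨(f (0 + 1)).2 - 1, fun i => ?_⟩
    have := hconst i
    have := (hW.2.2.1 i).fst_eq_add_one_or_sub_one
    omega
  · refine ⟨(f (0 + 1)).2, fun i => ?_⟩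
    have := hconst i
    have := (hW.2.2.1 i).fst_eq_add_one_or_sub_one
    omega

theorem exists_up_edge {y : ℤ → ℤ} {c : ℤ} (hk : 0 < k) (hper : ∀ i, y (i + k) = y i)
    (hy : ∀ i, y i = c ∨ y i = c + 1) {t : ℕ} (ht : y t ≠ y (t + 1)) :
    ∃ s : ℕ, y s = c ∧ y (s + 1) = c + 1 := by
  by_contra! hno
  have hlow : ∀ n : ℕ, y (t + 1 + n : ℤ) = c := by
    intro n
    induction n with
    | zero =>
      have := hno t
      have := hy t
      have := hy (t + 1)
      simp only [Nat.cast_zero, add_zero]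
      grind
    | succ n ih =>
      have := hno (t + 1 + n)
      have := hy (t + 1 + (n + 1 : ℕ))
      push_cast at *
      grind
  have h₁ := hlow (k - 1)
  have h₂ := hlow 0
  rw [show (t + 1 + (k - 1 : ℕ) : ℤ) = t + k by omega, hper] at h₁
  exact ht (h₁.trans (by simpa using h₂.symm))

/-- Two height changes per period, the first of them at `s`: the second one is at `s + n`. -/
theorem exists_unique_other_change {y : ℤ → ℤ} (hper : ∀ i, y (i + k) = y i)
    (hcard : ((Finset.range k).filter fun t : ℕ => y (t : ℤ) ≠ y ((t : ℤ) + 1)).card = 2)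
    {s : ℕ} (hs : y s ≠ y (s + 1)) :
    ∃ n : ℕ, 0 < n ∧ n < k ∧ ∀ t : ℕ, 0 < t → t < k →
      (y (s + t) ≠ y (s + t + 1) ↔ t = n) := by
  let p : ℕ → Prop := fun t => y (t : ℤ) ≠ y ((t : ℤ) + 1)
  have hp : Function.Periodic p k := by
    intro t
    simp only [p]
    push_cast
    rw [hper, show (t + k + 1 : ℤ) = t + 1 + k by ring, hper]
  have hcard' : ((Finset.Ico s (s + k)).filter p).card = 2 := by
    rw [Nat.filter_Ico_card_eq_of_periodic s k p hp, Nat.count_eq_card_filter_range]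
    exact hcard
  have hk : 0 < k := by
    rcases Nat.eq_zero_or_pos k with rfl | h
    · simp at hcard
    · exact h
  have hsmem : s ∈ (Finset.Ico s (s + k)).filter p := by
    simpa [p, hk] using hs
  obtain ⟨m, hm⟩ : ∃ m, ((Finset.Ico s (s + k)).filter p).erase s = {m} := by
    rw [← Finset.card_eq_one, Finset.card_erase_of_mem hsmem, hcard']
  have hiff : ∀ t, (t ≠ s ∧ (s ≤ t ∧ t < s + k) ∧ p t) ↔ t = m := by
    intro t
    simpa using congrArg (t ∈ ·) hm
  obtain ⟨h₁, h₂, -⟩ := (hiff m).2 rfl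
  refine ⟨m - s, by omega, by omega, fun t h₀ htk => ?_⟩
  have := hiff (s + t)
  simp only [p] at this
  push_cast at this
  constructor
  · intro h
    have := this.1 ⟨by omega, by omega, h⟩
    omega
  · intro h
    exact (this.2 (by omega)).2.2

/-- A walk that goes up at `s`, right along row `c + 1`, down at `s + n` and left along row `c`. -/
theorem walk_two_rows {c : ℤ} (hper : ∀ i, f (i + k) = f i)
    (hrow : ∀ i : ℤ, ((f (i + 1)).2 = c ∧ (f (i + 1)).1 = (f i).1 - 1) ∨
      ((f (i + 1)).2 = c + 1 ∧ (f (i + 1)).1 = (f i).1 + 1))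
    {s n : ℕ} (hs₁ : (f (s + 1)).2 = c + 1) (hn₀ : 0 < n) (hnk : n < k)
    (hn : ∀ t : ℕ, 0 < t → t < k → ((f (s + t)).2 ≠ (f (s + t + 1)).2 ↔ t = n)) :
    k = 2 * n ∧
    (∀ t : ℕ, 1 ≤ t → t ≤ n → f (s + t) = ((f s).1 + t, c + 1)) ∧
    (∀ t : ℕ, n < t → t ≤ k → f (s + t) = ((f s).1 + k - t, c)) := by
  have hup : ∀ t : ℕ, t + 1 ≤ n → f (s + (t + 1 : ℕ)) = ((f s).1 + (t + 1 : ℕ), c + 1) := by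
    intro t
    induction t with
    | zero =>
      intro _
      have := hrow s
      ext <;> simp <;> omega
    | succ t ih =>
      intro htn
      have h₁ := ih (by omega)
      have h₂ := hrow (s + (t + 1 : ℕ))
      have h₃ := hn (t + 1) (by omega) (by omega)
      rw [h₁] at h₂ h₃
      push_cast at *
      rw [← add_assoc (s : ℤ) ((t : ℤ) + 1) 1]
      ext <;> simp only <;> omega
  have hdown : ∀ t : ℕ, n + 1 + t ≤ k →
      f (s + (n + 1 + t : ℕ)) = ((f s).1 + 2 * n - (n + 1 + t : ℕ), c) := by
    intro t
    induction t with
    | zero =>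
      intro _
      have h₁ := hup (n - 1) (by omega)
      rw [show n - 1 + 1 = n by omega] at h₁
      have h₂ := hrow (s + n)
      have h₃ := hn n hn₀ hnk
      rw [h₁] at h₂ h₃
      push_cast at *
      rw [add_zero, ← add_assoc (s : ℤ) (n : ℤ) 1]
      ext <;> simp only <;> omega
    | succ t ih =>
      intro htn
      have h₁ := ih (by omega)
      have h₂ := hrow (s + (n + 1 + t : ℕ))
      have h₃ := hn (n + 1 + t) (by omega) (by omega)
      rw [h₁] at h₂ h₃
      push_cast at *
      rw [show (s + (n + 1 + (t + 1)) : ℤ) = s + (n + 1 + t) + 1 by ring]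
      ext <;> simp only <;> omega
  have hkn : k = 2 * n := by
    have h := hdown (k - (n + 1)) (by omega)
    rw [show n + 1 + (k - (n + 1)) = k by omega, hper] at h
    have := congrArg Prod.fst h
    simp only at this
    omega
  refine ⟨hkn, fun t h₁ h₂ => ?_, fun t h₁ h₂ => ?_⟩
  · have := hup (t - 1) (by omega)
    rwa [show t - 1 + 1 = t by omega] at this
  · have := hdown (t - (n + 1)) (by omega)
    rw [show n + 1 + (t - (n + 1)) = t by omega] at this
    rw [this, hkn]
    push_cast
    rfl

/-- A walk of period `k` that is injective on one window of length `k` is injective on every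
window of length `k`. -/
theorem ne_of_injOn_window {α : Type*} {g : ℤ → α} (hk : 0 < k) (hper : ∀ i, g (i + k) = g i)
    {s : ℤ} (hinj : ∀ u v : ℕ, 1 ≤ u → u ≤ k → 1 ≤ v → v ≤ k → g (s + u) = g (s + v) → u = v)
    {t₁ t₂ : ℤ} (h₁₂ : t₁ < t₂) (h : t₂ < t₁ + k) : g t₁ ≠ g t₂ := by
  have hg : Function.Periodic g (k : ℤ) := hper
  have hrep : ∀ t : ℤ, ∃ u : ℕ, 1 ≤ u ∧ u ≤ k ∧ (u : ℤ) = (t - s - 1) % k + 1 ∧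
      g t = g (s + u) := by
    intro t
    have h₀ := Int.emod_nonneg (t - s - 1) (b := (k : ℤ)) (by omega)
    have h₁ := Int.emod_lt_of_pos (t - s - 1) (b := (k : ℤ)) (by omega)
    refine ⟨((t - s - 1) % k + 1).toNat, by omega, by omega, by omega, ?_⟩
    rw [Int.toNat_of_nonneg (by omega), ← hg.sub_zsmul_eq ((t - s - 1) / k), smul_eq_mul]
    congr 1
    have := Int.mul_ediv_add_emod (t - s - 1) k
    linarith
  obtain ⟨u, hu₁, huk, hu, hgu⟩ := hrep t₁
  obtain ⟨v, hv₁, hvk, hv, hgv⟩ := hrep t₂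
  intro heq
  have huv := hinj u v hu₁ huk hv₁ hvk (by rw [← hgu, ← hgv, heq])
  have hmod : (t₂ - s - 1) % (k : ℤ) = (t₁ - s - 1) % (k : ℤ) := by omega
  have hdvd := Int.ModEq.dvd (n := (k : ℤ)) hmod.symm
  have := Int.le_of_dvd (by omega) hdvd
  omega

end Walk

/-- A closed right-turn walk in the brickwall with turning number 1
is a cycle (no repeated vertex) containing exactly two vertical edges; more precisely,
some rotation of it equals
`b_{a,j}, b_{a+1,j+1}, …, b_{a+2i+1,j+1}, b_{a+2i,j}, …, b_{a+1,j}, b_{a,j}`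
for some odd `a`, some `j` and some `i ≥ 1`. -/
theorem rightTurnWalk_turningNumber_one_form
    (k : ℕ) (f : ℤ → ℤ × ℤ) (hW : IsClosedWalk k f) (hR : IsRightTurnWalk f)
    (ht : turningNumber k f = 1) :
    (∀ t₁ t₂ : ℤ, 0 ≤ t₁ → t₁ < t₂ → t₂ < (k : ℤ) → f t₁ ≠ f t₂) ∧
    ((Finset.range k).filter fun t => (f (t : ℤ)).2 ≠ (f ((t : ℤ) + 1)).2).card = 2 ∧
    ∃ (a j s : ℤ) (i : ℕ), Odd a ∧ 1 ≤ i ∧ k = 4 * i + 2 ∧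
      f s = (a, j) ∧
      (∀ t : ℤ, 1 ≤ t → t ≤ 2 * (i : ℤ) + 1 → f (s + t) = (a + t, j + 1)) ∧
      (∀ t : ℤ, 2 * (i : ℤ) + 2 ≤ t → t ≤ 4 * (i : ℤ) + 2 →
        f (s + t) = (a + (4 * (i : ℤ) + 2) - t, j)) := by
  have hk := hW.1
  have hcard : ((Finset.range k).filter fun t : ℕ =>
      (f (t : ℤ)).2 ≠ (f ((t : ℤ) + 1)).2).card = 2 := by
    have := card_vertical_eq hW hR
    rw [ht, mul_one] at this
    exact_mod_cast this
  obtain ⟨c, hrow⟩ := exists_rows hW hR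
  have hper₂ : ∀ i, (f (i + k)).2 = (f i).2 := fun i => by rw [hW.2.1]
  have hrows : ∀ i, (f i).2 = c ∨ (f i).2 = c + 1 := fun i => by
    have := hrow (i - 1)
    rw [sub_add_cancel] at this
    omega
  obtain ⟨t₀, ht₀⟩ : ((Finset.range k).filter fun t : ℕ =>
      (f (t : ℤ)).2 ≠ (f ((t : ℤ) + 1)).2).Nonempty := by
    rw [← Finset.card_pos, hcard]
    norm_num
  obtain ⟨s, hs₀, hs₁⟩ := exists_up_edge (y := fun i => (f i).2) hk hper₂
    hrows
    (Finset.mem_filter.1 ht₀).2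
  have hsv : (f s).2 ≠ (f (s + 1)).2 := by omega
  obtain ⟨n, hn₀, hnk, hn⟩ :=
    exists_unique_other_change (y := fun i => (f i).2) hper₂ hcard hsv
  obtain ⟨hkn, hup, hdown⟩ := walk_two_rows hW.2.1 hrow hs₁ hn₀ hnk hn
  have hodd : (f s).1 % 2 = 1 := by
    have := hW.2.2.1 s
    simp only [bwAdj, Int.odd_iff] at this
    omega
  have hnodd : n % 2 = 1 := by
    have h := hW.2.2.1 (s + n)
    have h' := hdown (n + 1) (by omega) (by omega)
    push_cast at h'
    rw [← add_assoc] at h'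
    rw [h', hup n hn₀ le_rfl] at h
    simp only [bwAdj, Int.odd_iff] at h
    omega
  have hn_ne : n ≠ 1 := by
    rintro rfl
    have h := (hR s hsv).1.1
    have h' := hdown 2 (by omega) (by omega)
    push_cast at h'
    rw [h'] at h
    simp only at h
    omega
  refine ⟨fun t₁ t₂ h₁ h₁₂ h₂ => ne_of_injOn_window (s := s) hk hW.2.1 ?_ h₁₂ (by omega),
    (card_filter_range_cast k _).trans hcard,
    (f s).1, c, s, (n - 1) / 2, Int.odd_iff.2 hodd, by omega, by omega, Prod.ext rfl hs₀,
    fun t h₁ h₂ => ?_, fun t h₁ h₂ => ?_⟩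
  · intro u v hu₁ huk hv₁ hvk huv
    rcases le_or_gt u n with hu | hu <;> rcases le_or_gt v n with hv | hv
    · rw [hup u hu₁ hu, hup v hv₁ hv, Prod.mk.injEq] at huv
      omega
    · rw [hup u hu₁ hu, hdown v hv hvk, Prod.mk.injEq] at huv
      omega
    · rw [hdown u hu huk, hup v hv₁ hv, Prod.mk.injEq] at huv
      omega
    · rw [hdown u hu huk, hdown v hv hvk, Prod.mk.injEq] at huv
      omega
  · lift t to ℕ using by omega
    exact hup t (by omega) (by omega)
  · lift t to ℕ using by omega
    rw [hdown t (by omega) (by omega), Prod.mk.injEq]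
    omega

end Hex
end

section
/- Every cycle of length 6 in the brickwall 𝓑 is a facial cycle: its vertex set equals {b_{i,j}, b_{i+1,j}, b_{i+2,j}, b_{i+1,j+1}, b_{i+2,j+1}, b_{i+3,j+1}} for some odd i ∈ ℤ and some j ∈ ℤ. -/
open scoped Classical

namespace Hex

theorem bwAdj_of_odd {u v : ℤ × ℤ} (h : bwAdj u v) (hu : Odd u.1) :
    Odd (v.1 + 1) ∧
      (v = (u.1 + 1, u.2) ∨ v = (u.1 - 1, u.2) ∨ v = (u.1 + 1, u.2 + 1)) := by
  obtain ⟨x, y⟩ := u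
  obtain ⟨z, w⟩ := v
  simp only [bwAdj, Prod.mk.injEq, Int.odd_iff] at *
  omega

theorem bwAdj_of_even {u v : ℤ × ℤ} (h : bwAdj u v) (hu : Odd (u.1 + 1)) :
    Odd v.1 ∧
      (v = (u.1 + 1, u.2) ∨ v = (u.1 - 1, u.2) ∨ v = (u.1 - 1, u.2 - 1)) := by
  obtain ⟨x, y⟩ := u
  obtain ⟨z, w⟩ := v
  simp only [bwAdj, Prod.mk.injEq, Int.odd_iff] at *
  omega

/-- The vertex set of the facial cycle whose lower left corner is `b_{i,j}`. -/
def faceVertices (i j : ℤ) : Set (ℤ × ℤ) :=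
  {(i, j), (i + 1, j), (i + 2, j), (i + 1, j + 1), (i + 2, j + 1), (i + 3, j + 1)}

/-- A non-backtracking closed walk of length 6 that starts at a vertex with odd first
coordinate goes around a face. -/
theorem exists_faceVertices_of_odd {a b c d e g : ℤ × ℤ} (ha : Odd a.1)
    (hab : bwAdj a b) (hbc : bwAdj b c) (hcd : bwAdj c d) (hde : bwAdj d e)
    (heg : bwAdj e g) (hga : bwAdj g a)
    (hac : a ≠ c) (hbd : b ≠ d) (hce : c ≠ e) (hdg : d ≠ g) (hea : e ≠ a) (hgb : g ≠ b) :
    ∃ i j : ℤ, Odd i ∧ ({a, b, c, d, e, g} : Set (ℤ × ℤ)) = faceVertices i j := by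
  obtain ⟨hb, hab⟩ := bwAdj_of_odd hab ha
  obtain ⟨hc, hbc⟩ := bwAdj_of_even hbc hb
  obtain ⟨hd, hcd⟩ := bwAdj_of_odd hcd hc
  obtain ⟨he, hde⟩ := bwAdj_of_even hde hd
  obtain ⟨hg, heg⟩ := bwAdj_of_odd heg he
  obtain ⟨-, hga⟩ := bwAdj_of_even hga hg
  clear hb hc hd he hg
  obtain ⟨x, y⟩ := a
  have odd_sub : Odd (x - 2) := by
    simp only [Int.odd_iff] at *
    omega
  have corner : ({(x, y), b, c, d, e, g} : Set (ℤ × ℤ)) = faceVertices x y ∨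
      ({(x, y), b, c, d, e, g} : Set (ℤ × ℤ)) = faceVertices (x - 2) y ∨
      ({(x, y), b, c, d, e, g} : Set (ℤ × ℤ)) = faceVertices (x - 2) (y - 1) := by
    rcases hab with rfl | rfl | rfl <;> rcases hbc with rfl | rfl | rfl <;>
      simp only [ne_eq, Prod.mk.injEq, not_and] at hac <;> try omega
    all_goals
      rcases hcd with rfl | rfl | rfl <;> simp only [ne_eq, Prod.mk.injEq, not_and] at hbd <;>
        try omega
    all_goals
      rcases hde with rfl | rfl | rfl <;>
        simp only [ne_eq, Prod.mk.injEq, not_and] at hce hea <;> try omega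
    all_goals
      rcases heg with rfl | rfl | rfl <;>
        simp only [ne_eq, Prod.mk.injEq, not_and] at hdg hgb hga <;> try omega
    all_goals
      simp only [Set.ext_iff, faceVertices, Set.mem_insert_iff, Set.mem_singleton_iff]
      ring_nf
      first
        | left; intro p; grind only
        | right; left; intro p; grind only
        | right; right; intro p; grind only
  rcases corner with h | h | h
  exacts [⟨_, _, ha, h⟩, ⟨_, _, odd_sub, h⟩, ⟨_, _, odd_sub, h⟩]

/-- Every cycle of length 6 in the brickwall `𝓑` is a facial cycle:
its vertex set is `{b_{i,j}, b_{i+1,j}, b_{i+2,j}, b_{i+1,j+1}, b_{i+2,j+1}, b_{i+3,j+1}}`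
for some odd `i` and some `j`. -/
theorem six_cycle_is_facial
    (f : ℤ → ℤ × ℤ) (hW : IsClosedWalk 6 f)
    (hdist : ∀ t₁ t₂ : ℤ, 0 ≤ t₁ → t₁ < t₂ → t₂ < 6 → f t₁ ≠ f t₂) :
    ∃ i j : ℤ, Odd i ∧
      ({f 0, f 1, f 2, f 3, f 4, f 5} : Set (ℤ × ℤ)) =
        {(i, j), (i + 1, j), (i + 2, j), (i + 1, j + 1), (i + 2, j + 1), (i + 3, j + 1)} := by
  obtain ⟨-, hper, hadj, -⟩ := hW
  have h6 : f 6 = f 0 := by simpa using hper 0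
  have h01 : bwAdj (f 0) (f 1) := by simpa using hadj 0
  have h12 : bwAdj (f 1) (f 2) := by simpa using hadj 1
  have h23 : bwAdj (f 2) (f 3) := by simpa using hadj 2
  have h34 : bwAdj (f 3) (f 4) := by simpa using hadj 3
  have h45 : bwAdj (f 4) (f 5) := by simpa using hadj 4
  have h50 : bwAdj (f 5) (f 0) := by simpa [h6] using hadj 5
  have d02 : f 0 ≠ f 2 := hdist 0 2 (by simp) (by simp) (by simp)
  have d13 : f 1 ≠ f 3 := hdist 1 3 (by simp) (by simp) (by simp)
  have d24 : f 2 ≠ f 4 := hdist 2 4 (by simp) (by simp) (by simp)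
  have d35 : f 3 ≠ f 5 := hdist 3 5 (by simp) (by simp) (by simp)
  have d04 : f 0 ≠ f 4 := hdist 0 4 (by simp) (by simp) (by simp)
  have d15 : f 1 ≠ f 5 := hdist 1 5 (by simp) (by simp) (by simp)
  rcases Int.even_or_odd (f 0).1 with h0 | h0
  · have h1 := (bwAdj_of_even h01 h0.add_one).1
    obtain ⟨i, j, hi, h⟩ :=
      exists_faceVertices_of_odd h1 h12 h23 h34 h45 h50 h01 d13 d24 d35 d04.symm d15.symm d02
    refine ⟨i, j, hi, Eq.trans ?_ h⟩
    ext p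
    simp only [Set.mem_insert_iff, Set.mem_singleton_iff]
    tauto
  · exact exists_faceVertices_of_odd h0 h01 h12 h23 h34 h45 h50 d02 d13 d24 d35 d04.symm d15.symm

end Hex
end

section
/- A closed right-turn walk in the brickwall 𝓑 has no PA-indices. -/
open scoped Classical

namespace Hex

/-- A closed right-turn walk in the brickwall `𝓑` has no PA-indices. -/
theorem rightTurnWalk_no_PAIndex
    (k : ℕ) (f : ℤ → ℤ × ℤ) (hW : IsClosedWalk k f) (hR : IsRightTurnWalk f) :
    ∀ i : ℤ, ¬ IsPAIndex k f i := by
  rintro i ⟨-, -, hL, hT⟩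
  obtain ⟨-, -, hadj, -⟩ := hW
  have hp : bwAdj (f (i - 1)) (f i) := by simpa using hadj (i - 1)
  have hn : bwAdj (f i) (f (i + 1)) := hadj i
  have hin : (f (i - 1)).2 ≠ (f i).2 → HorizRight (f i) (f (i + 1)) := by
    intro h
    have := (hR (i - 1) (by simpa using h)).1
    rwa [sub_add_cancel, show i - 1 + 2 = i + 1 by ring] at this
  have hout : (f i).2 ≠ (f (i + 1)).2 → HorizLeft (f (i - 1)) (f i) := fun h => (hR i h).2
  unfold LeftTurn at hL
  unfold thirdNb at hT
  generalize f (i - 1) = p at *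
  generalize f (i + 1) = n at *
  generalize f i = v at *
  obtain ⟨a, b⟩ := p
  obtain ⟨c, d⟩ := v
  obtain ⟨x, y⟩ := n
  simp only [bwAdj, HorizRight, HorizLeft, cwNext, Int.odd_iff, Int.even_iff] at *
  rcases Int.emod_two_eq_zero_or_one c with hc | hc <;>
    rcases hp with ⟨h, h' | h'⟩ | ⟨h, h', h''⟩ | ⟨h, h', h''⟩ <;>
    grind

end Hex
end

section
/- Let A be a proper assignment set for a closed walk W in the brickwall 𝓑, and suppose {0, y} ∈ A with n(y) = 0. Let W' = W_{0,y} ∘ H_{y,0} and A' = A \ {{0,y}}. Then an index i is a PA-index of W' if and only if i is a PA-index of W with i ∉ {0, y}, and A' is a proper assignment set for W'. -/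
open scoped Classical

namespace Hex

/-- The local condition on three consecutive vertices `a, b, c` of a walk that makes the middle
one a PA-index. -/
def IsPATurn (a b c : ℤ × ℤ) : Prop :=
  c = cwNext b a ∧ (if cwNext b c = a then cwNext b a else cwNext b c).2 = b.2

theorem isPAIndex_iff (k : ℕ) (f : ℤ → ℤ × ℤ) (i : ℤ) :
    IsPAIndex k f i ↔ 0 ≤ i ∧ i < (k : ℤ) ∧ IsPATurn (f (i - 1)) (f i) (f (i + 1)) :=
  Iff.rfl

theorem not_isPATurn_horizontal {x h s : ℤ} (hs : s = 1 ∨ s = -1) :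
    ¬ IsPATurn (x - s, h) (x, h) (x + s, h) := by
  unfold IsPATurn cwNext
  rcases hs with rfl | rfl <;> rcases Int.emod_two_eq_zero_or_one x with hx | hx <;>
    simp [hx, Prod.ext_iff] <;> grind

/-- Taking the clockwise successor around `v` is injective on the neighbors of `v`. -/
theorem cwNext_inj {u u' v : ℤ × ℤ} (hu : bwAdj u v) (hu' : bwAdj u' v)
    (h : cwNext v u = cwNext v u') : u = u' := by
  obtain ⟨u₁, u₂⟩ := u
  obtain ⟨u₁', u₂'⟩ := u'
  obtain ⟨v₁, v₂⟩ := v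
  simp only [bwAdj, Int.odd_iff] at hu hu'
  simp only [cwNext, Prod.mk.injEq] at h ⊢
  split_ifs at h <;> simp only [Prod.mk.injEq] at h <;> omega

/-- At a PA-turn, replacing the predecessor by the third neighbor, which is horizontal,
destroys the PA-turn. -/
theorem IsPATurn.not_replace_left {a b c : ℤ × ℤ} {s : ℤ} (hs : s = 1 ∨ s = -1)
    (h : IsPATurn a b c) (hab : bwAdj a b) (ha : (b.1 + s, b.2) ≠ a) :
    ¬ IsPATurn (b.1 + s, b.2) b c :=
  fun h' => ha (cwNext_inj (v := b) (Or.inl ⟨rfl, by dsimp only; omega⟩) hab (h'.1.symm.trans h.1))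

/-- At a PA-turn, replacing the successor by the third neighbor, which is horizontal,
destroys the PA-turn. -/
theorem IsPATurn.not_replace_right {a b c : ℤ × ℤ} {s : ℤ}
    (h : IsPATurn a b c) (hc : (b.1 + s, b.2) ≠ c) :
    ¬ IsPATurn a b (b.1 + s, b.2) :=
  fun h' => hc (h'.1.trans h.1.symm)

theorem horizPath_of_le {u v : ℤ × ℤ} (h : u.1 ≤ v.1) :
    horizPath u v =
      (List.range ((v.1 - u.1).toNat + 1)).map fun t : ℕ => (u.1 + (t : ℤ), u.2) := by
  rw [horizPath, if_pos h]
  simp [List.map_eq_flatMap, List.flatMap_assoc]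

theorem horizPath_of_lt {u v : ℤ × ℤ} (h : v.1 < u.1) :
    horizPath u v =
      (List.range ((u.1 - v.1).toNat + 1)).map fun t : ℕ => (u.1 - (t : ℤ), u.2) := by
  rw [horizPath, if_neg (not_le.2 h)]
  simp [List.map_eq_flatMap, List.flatMap_assoc]

theorem subwalkList_eq_map (k : ℕ) (f : ℤ → ℤ × ℤ) (x y : ℤ) :
    subwalkList k f x y =
      (List.range (((y - x) % (k : ℤ)).toNat + 1)).map fun t : ℕ => f (x + (t : ℤ)) := by
  simp [subwalkList, List.map_eq_flatMap, List.flatMap_assoc]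

theorem mem_horizPath_iff {u v z : ℤ × ℤ} :
    z ∈ horizPath u v ↔ z.2 = u.2 ∧ min u.1 v.1 ≤ z.1 ∧ z.1 ≤ max u.1 v.1 := by
  obtain ⟨z₁, z₂⟩ := z
  rcases le_or_gt u.1 v.1 with h | h
  · simp only [horizPath_of_le h, List.mem_map, List.mem_range, Prod.mk.injEq]
    constructor
    · rintro ⟨t, ht, rfl, rfl⟩
      omega
    · rintro ⟨rfl, h1, h2⟩
      exact ⟨(z₁ - u.1).toNat, by omega, by omega, rfl⟩
  · simp only [horizPath_of_lt h, List.mem_map, List.mem_range, Prod.mk.injEq]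
    constructor
    · rintro ⟨t, ht, rfl, rfl⟩
      omega
    · rintro ⟨rfl, h1, h2⟩
      exact ⟨(u.1 - z₁).toNat, by omega, by omega, rfl⟩

theorem mem_horizPath_comm {u v z : ℤ × ℤ} (h : u.2 = v.2) :
    z ∈ horizPath u v ↔ z ∈ horizPath v u := by
  rw [mem_horizPath_iff, mem_horizPath_iff, h, min_comm, max_comm]

theorem mem_horizPath {u v : ℤ × ℤ} {s : ℤ} {d t : ℕ} (hs : s = 1 ∨ s = -1)
    (hd : v.1 = u.1 + s * d) (ht : t ≤ d) : (u.1 + s * t, u.2) ∈ horizPath u v := by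
  rw [mem_horizPath_iff]
  rcases hs with rfl | rfl <;> dsimp only <;> omega

theorem horizPath_dropLast {u v : ℤ × ℤ} {s : ℤ} {d : ℕ} (hs : s = 1 ∨ s = -1) (hd0 : 0 < d)
    (hd : v.1 = u.1 + s * d) :
    (horizPath u v).dropLast = (List.range d).map fun t : ℕ => (u.1 + s * (t : ℤ), u.2) := by
  rcases hs with rfl | rfl
  · rw [horizPath_of_le (by omega), show (v.1 - u.1).toNat = d by omega]
    simp [List.range_succ]
  · rw [horizPath_of_lt (by omega), show (u.1 - v.1).toNat = d by omega]
    simp [List.range_succ, sub_eq_add_neg]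

theorem listFun_add_length (L : List (ℤ × ℤ)) (i : ℤ) : listFun L (i + L.length) = listFun L i := by
  simp [listFun]

theorem listFun_natCast (L : List (ℤ × ℤ)) {n : ℕ} (hn : n < L.length) :
    listFun L n = L[n] := by
  unfold listFun
  rw [Int.emod_eq_of_lt (by omega) (by omega)]
  simp [hn]

/-- The split walk in coordinates: it has length `n + d`, follows `f` on `[0, n]`, and then moves
horizontally in direction `s` until it closes up. -/
theorem splitFun_spec {k : ℕ} {f : ℤ → ℤ × ℤ} {n d : ℕ} {s : ℤ} (hs : s = 1 ∨ s = -1)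
    (hn : n < k) (hn0 : 0 < n) (hd0 : 0 < d) (hd : (f 0).1 = (f n).1 + s * d)
    (hh : (f 0).2 = (f n).2) :
    splitLen k f n = n + d ∧ (∀ t : ℕ, t ≤ n → splitFun k f n t = f t) ∧
      (∀ t : ℕ, t ≤ d → splitFun k f n (n + t) = ((f n).1 + s * t, (f n).2)) ∧
      splitFun k f n (-1) = ((f 0).1 - s, (f 0).2) := by
  have hL : splitList k f n = ((List.range n).map fun t : ℕ => f t) ++
      (List.range d).map fun t : ℕ => ((f n).1 + s * (t : ℤ), (f n).2) := by
    unfold splitList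
    rw [horizPath_dropLast hs hd0 hd]
    congr 1
    rw [subwalkList_eq_map, sub_zero, Int.emod_eq_of_lt (by omega) (by omega)]
    simp [List.range_succ]
  have hlen : (splitList k f n).length = n + d := by simp [hL]
  have h1 : ∀ t : ℕ, t < n → splitFun k f n t = f t := by
    intro t ht
    unfold splitFun
    rw [listFun_natCast _ (by omega)]
    simp [hL, ht]
  have h2 : ∀ t : ℕ, t < d → splitFun k f n (n + t) = ((f n).1 + s * t, (f n).2) := by
    intro t ht
    unfold splitFun
    rw [← Nat.cast_add, listFun_natCast _ (by omega)]
    simp [hL]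
  have hper : ∀ i : ℤ, splitFun k f n (i + (n + d : ℕ)) = splitFun k f n i := by
    intro i
    rw [← hlen]
    exact listFun_add_length _ _
  refine ⟨hlen, ?_, ?_, ?_⟩
  · intro t ht
    rcases ht.lt_or_eq with h | rfl
    · exact h1 t h
    · simpa using h2 0 hd0
  · intro t ht
    rcases ht.lt_or_eq with h | rfl
    · exact h2 t h
    · have h := hper 0
      have h0 := h1 0 hn0
      push_cast at h h0
      rw [zero_add] at h
      rw [h, h0, ← hd, ← hh]
  · rw [← hper, show (-1 + ((n + d : ℕ) : ℤ)) = n + ((d - 1 : ℕ) : ℤ) by omega, h2 _ (by omega)]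
    have hcast : ((d - 1 : ℕ) : ℤ) = d - 1 := by omega
    rw [hcast, hd, hh]
    ext <;> simp
    ring

/-- If `{x, y}` is a possible assignment, the witnesses may be taken in this order. -/
theorem IsPA.pair {k : ℕ} {f : ℤ → ℤ × ℤ} {x y : ℤ} (h : IsPA k f {x, y}) :
    IsPAIndex k f x ∧ IsPAIndex k f y ∧ f x ≠ f y ∧ (f x).2 = (f y).2 ∧
      ∀ z ∈ horizPath (f x) (f y),
        z ≠ f (x - 1) ∧ z ≠ f (x + 1) ∧ z ≠ f (y - 1) ∧ z ≠ f (y + 1) := by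
  obtain ⟨a, b, hp, ha, hb, hne, hh, hz⟩ := h
  have key : (a = x ∧ b = y) ∨ (a = y ∧ b = x) := by
    have hab : a ≠ b := fun h => hne (congrArg f h)
    have h1 : a = x ∨ a = y := by
      have : a ∈ ({x, y} : Finset ℤ) := by simp [hp]
      simpa using this
    have h2 : b = x ∨ b = y := by
      have : b ∈ ({x, y} : Finset ℤ) := by simp [hp]
      simpa using this
    omega
  rcases key with ⟨rfl, rfl⟩ | ⟨rfl, rfl⟩
  · exact ⟨ha, hb, hne, hh, hz⟩
  · refine ⟨hb, ha, hne.symm, hh.symm, fun z hz' => ?_⟩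
    obtain ⟨h1, h2, h3, h4⟩ := hz z ((mem_horizPath_comm hh).2 hz')
    exact ⟨h3, h4, h1, h2⟩

/-- If `n(y) = 0` then every PA-index is at most `y`. -/
theorem le_of_nextPA_eq_zero {k : ℕ} {f : ℤ → ℤ × ℤ} {y i : ℤ} (h0 : IsPAIndex k f 0)
    (hy : IsPAIndex k f y) (hny : nextPA k f y = 0) (hi : IsPAIndex k f i) : i ≤ y := by
  have hk : (0 : ℤ) < k := h0.2.1
  have hex : ∃ j : ℤ, IsPAIndex k f j ∧ ∀ j' : ℤ, IsPAIndex k f j' →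
      (j - y - 1) % (k : ℤ) ≤ (j' - y - 1) % (k : ℤ) := by
    have hfin : {j : ℤ | IsPAIndex k f j}.Finite :=
      (Set.finite_Ico (0 : ℤ) k).subset fun j hj => ⟨hj.1, hj.2.1⟩
    exact Set.exists_min_image _ (fun j => (j - y - 1) % (k : ℤ)) hfin ⟨0, h0⟩
  have hmin := hex.choose_spec.2 i hi
  rw [nextPA, dif_pos hex] at hny
  rw [hny] at hmin
  by_contra hlt
  have hik := hi.2.1
  have hy0 := hy.1
  have hyk := hy.2.1
  rw [← Int.add_emod_right, Int.emod_eq_of_lt (by omega) (by omega),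
    Int.emod_eq_of_lt (by omega) (by omega)] at hmin
  omega

/-- Let `A` be a proper assignment set for a closed walk `W` in the
brickwall with `{0, y} ∈ A` and `n(y) = 0`, and let `W' = W_{0,y} ∘ H_{y,0}` and
`A' = A \ {{0,y}}`. Then `i` is a PA-index of `W'` iff `i` is a PA-index of `W` with
`i ∉ {0, y}`, and `A'` is a proper assignment set for `W'`. -/
theorem split_PAIndex_iff_and_proper
    (k : ℕ) (f : ℤ → ℤ × ℤ) (A : Set (Finset ℤ)) (y : ℤ)
    (hW : IsClosedWalk k f) (hA : IsProperAssignment k f A)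
    (hmem : ({0, y} : Finset ℤ) ∈ A) (hny : nextPA k f y = 0) :
    (∀ i : ℤ, IsPAIndex (splitLen k f y) (splitFun k f y) i ↔
      (IsPAIndex k f i ∧ i ≠ 0 ∧ i ≠ y)) ∧
    IsProperAssignment (splitLen k f y) (splitFun k f y)
      (A \ {({0, y} : Finset ℤ)}) := by
  have hPA := (hA.1 _ hmem).pair
  obtain ⟨h0, hy, hne, hh, hz⟩ := hPA
  have hle : ∀ i, IsPAIndex k f i → i ≤ y := fun i hi => le_of_nextPA_eq_zero h0 hy hny hi
  obtain ⟨n, rfl⟩ := Int.eq_ofNat_of_zero_le hy.1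
  have hn0 : 0 < n := Nat.pos_of_ne_zero fun h => hne (by simp [h])
  have hnk : n < k := by exact_mod_cast hy.2.1
  obtain ⟨s, d, hs, hd0, hd⟩ : ∃ (s : ℤ) (d : ℕ), (s = 1 ∨ s = -1) ∧ 0 < d ∧
      (f 0).1 = (f n).1 + s * d := by
    have h1 : (f 0).1 ≠ (f n).1 := fun h => hne (Prod.ext h hh)
    rcases lt_or_gt_of_ne h1 with h | h
    · exact ⟨-1, ((f n).1 - (f 0).1).toNat, by simp, by omega, by omega⟩
    · exact ⟨1, ((f 0).1 - (f n).1).toNat, by simp, by omega, by omega⟩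
  obtain ⟨hlen, hgf, hgH, hgneg⟩ := splitFun_spec (k := k) hs hnk hn0 hd0 hd hh
  set g := splitFun k f n
  set m := splitLen k f n
  have hgf' : ∀ i : ℤ, 0 ≤ i → i ≤ n → g i = f i := by
    intro i hi hin
    obtain ⟨t, rfl⟩ := Int.eq_ofNat_of_zero_le hi
    exact hgf t (by omega)
  have hmemH : ∀ t : ℕ, t ≤ d → ((f n).1 + s * t, (f n).2) ∈ horizPath (f 0) (f n) :=
    fun t ht => (mem_horizPath_comm hh).2 (mem_horizPath hs hd ht)
  have hiff : ∀ i : ℤ, IsPAIndex m g i ↔ (IsPAIndex k f i ∧ i ≠ 0 ∧ i ≠ n) := by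
    intro i
    by_cases hi : 0 < i ∧ i < n
    · rw [isPAIndex_iff, isPAIndex_iff, hgf' i (by omega) (by omega),
        hgf' (i - 1) (by omega) (by omega), hgf' (i + 1) (by omega) (by omega)]
      constructor
      · rintro ⟨-, -, h⟩
        exact ⟨⟨by omega, by omega, h⟩, by omega, by omega⟩
      · rintro ⟨⟨-, -, h⟩, -, -⟩
        exact ⟨by omega, by omega, h⟩
    · refine iff_of_false ?_ ?_
      · rw [isPAIndex_iff]
        rintro ⟨hi0, him, hturn⟩
        rcases hi0.eq_or_lt with rfl | hpos
        · have hprev : g (0 - 1) = ((f 0).1 + -s, (f 0).2) := hgneg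
          rw [hprev, hgf' 0 le_rfl (by omega), hgf' (0 + 1) (by omega) (by omega)] at hturn
          refine IsPATurn.not_replace_left (s := -s) (by omega) h0.2.2 ?_ ?_ hturn
          · simpa using hW.2.2.1 (0 - 1)
          · have h := (hz _ (hmemH (d - 1) (by omega))).1
            have hcast : ((d - 1 : ℕ) : ℤ) = d - 1 := by omega
            rw [hcast] at h
            convert h using 2
            rw [hd]
            ring
        · obtain ⟨t, rfl⟩ : ∃ t : ℕ, i = n + t := ⟨(i - n).toNat, by omega⟩
          have hnext := hgH (t + 1) (by omega)
          rcases Nat.eq_zero_or_pos t with rfl | ht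
          · have hnext' : g ((n + (0 : ℕ) : ℤ) + 1) = ((f n).1 + s, (f n).2) := by
              simpa using hnext
            rw [hnext'] at hturn
            simp only [Nat.cast_zero, add_zero] at hturn
            rw [hgf' n (by omega) le_rfl, hgf' (n - 1) (by omega) (by omega)] at hturn
            refine IsPATurn.not_replace_right hy.2.2 ?_ hturn
            simpa using (hz _ (hmemH 1 hd0)).2.2.2
          · have hprev := hgH (t - 1) (by omega)
            have hcast : ((t - 1 : ℕ) : ℤ) = t - 1 := by omega
            push_cast at hnext
            rw [hcast] at hprev
            rw [add_sub_assoc, hprev, add_assoc, hnext, hgH t (by omega)] at hturn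
            refine not_isPATurn_horizontal (x := (f n).1 + s * t) (h := (f n).2) hs ?_
            convert hturn using 2 <;> ring
      · rintro ⟨hi', hi0, hin⟩
        have := hle i hi'
        have := hi'.1
        omega
  have hmemPA : ∀ p ∈ A, ∀ i ∈ p, IsPAIndex k f i := by
    intro p hp i hi
    obtain ⟨a, b, rfl, ha, hb, -⟩ := hA.1 p hp
    rcases Finset.mem_insert.1 hi with rfl | hi
    · exact ha
    · rwa [Finset.mem_singleton.1 hi]
  have hdisj : ∀ p ∈ A \ {({0, (n : ℤ)} : Finset ℤ)}, ∀ i ∈ p, i ≠ 0 ∧ i ≠ n := by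
    rintro p ⟨hp, hpne⟩ i hi
    have huniq := (hA.2.1 i (hmemPA p hp i hi)).unique (y₂ := {0, (n : ℤ)}) ⟨hp, hi⟩
    constructor <;> rintro rfl <;> exact hpne (huniq ⟨hmem, by simp⟩)
  refine ⟨hiff, ?_, ?_, ?_⟩
  · intro p hp
    obtain ⟨a, b, rfl, ha, hb, hrest⟩ := hA.1 p hp.1
    obtain ⟨ha0, han⟩ := hdisj _ hp a (by simp)
    obtain ⟨hb0, hbn⟩ := hdisj _ hp b (by simp)
    have hale := hle a ha
    have hble := hle b hb
    have hapos := ha.1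
    have hbpos := hb.1
    refine ⟨a, b, rfl, (hiff a).2 ⟨ha, ha0, han⟩, (hiff b).2 ⟨hb, hb0, hbn⟩, ?_⟩
    rw [hgf' a (by omega) (by omega), hgf' b (by omega) (by omega),
      hgf' (a - 1) (by omega) (by omega), hgf' (a + 1) (by omega) (by omega),
      hgf' (b - 1) (by omega) (by omega), hgf' (b + 1) (by omega) (by omega)]
    exact hrest
  · intro i hi
    obtain ⟨hi', hi0, hin⟩ := (hiff i).1 hi
    obtain ⟨p, ⟨hp, hip⟩, huniq⟩ := hA.2.1 i hi'
    refine ⟨p, ⟨⟨hp, ?_⟩, hip⟩, fun q hq => huniq q ⟨hq.1.1, hq.2⟩⟩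
    rintro rfl
    simp [hi0, hin] at hip
  · exact fun p hp q hq => hA.2.2 p hp.1 q hq.1

end Hex
end
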